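/- Let (X,d,m) be a proper geodesic Monge space and K_0, K_1 ⊂ X compact. Then the map Π sending a pair (μ_0, μ_1), with μ_0 a probability measure absolutely continuous with respect to m concentrated on K_0 and μ_1 a probability measure concentrated on K_1, to the unique optimal dynamical plan π ∈ OptGeo(μ_0, μ_1), is continuous from P^m(K_0) × P(K_1) (with the product of narrow topologies) to P(Geo(X,d)) with the narrow topology. -/

import Mathlib

open MeasureTheory Metric Set Filter Topology Bornology unitInterval ENNReal NNReal

noncomputable section

/-- A constant-speed geodesic parametrized on the unit interval. -/
def IsCSGeodesic {X : Type*} [MetricSpace X] (γ : C(unitInterval, X)) : Prop :=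
  ∀ s t : unitInterval, dist (γ s) (γ t) = |(t : ℝ) - (s : ℝ)| * dist (γ 0) (γ 1)

instance pathMeasurableSpace {X : Type*} [MetricSpace X] :
    MeasurableSpace C(unitInterval, X) := borel _

instance pathBorelSpace {X : Type*} [MetricSpace X] :
    BorelSpace C(unitInterval, X) := ⟨rfl⟩

/-- The squared `L²`-Wasserstein distance. -/
def W2sq {X : Type*} [MetricSpace X] [MeasurableSpace X] (μ0 μ1 : Measure X) : ℝ≥0∞ :=
  ⨅ (π : Measure (X × X)) (_ : π.map Prod.fst = μ0 ∧ π.map Prod.snd = μ1),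
    ∫⁻ p, edist p.1 p.2 ^ 2 ∂π

/-- `π` is an optimal dynamical plan connecting `μ0` and `μ1`. -/
def IsOptDynPlan {X : Type*} [MetricSpace X] [MeasurableSpace X]
    (π : Measure C(unitInterval, X)) (μ0 μ1 : Measure X) : Prop :=
  IsProbabilityMeasure π ∧
  π {γ | ¬ IsCSGeodesic γ} = 0 ∧
  π.map (fun γ => γ 0) = μ0 ∧
  π.map (fun γ => γ 1) = μ1 ∧
  ∫⁻ γ, edist (γ 0) (γ 1) ^ 2 ∂π = W2sq μ0 μ1

/-- Finite second moment. -/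
def FinSecondMoment {X : Type*} [MetricSpace X] [MeasurableSpace X] (μ : Measure X) : Prop :=
  ∃ x0 : X, ∫⁻ x, edist x x0 ^ 2 ∂μ ≠ ⊤

/-- Monge space: uniqueness of the optimal dynamical plan, good transport behavior,
and the strong interpolation property. -/
def IsMonge {X : Type*} [MetricSpace X] [MeasurableSpace X] (m : Measure X) : Prop :=
  ∀ μ0 μ1 : Measure X, IsProbabilityMeasure μ0 → IsProbabilityMeasure μ1 →
    FinSecondMoment μ0 → FinSecondMoment μ1 → μ0 ≪ m →
    (∃! π : Measure C(unitInterval, X), IsOptDynPlan π μ0 μ1) ∧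
    ∀ π : Measure C(unitInterval, X), IsOptDynPlan π μ0 μ1 →
      (∃ T : X → C(unitInterval, X), π = μ0.map T) ∧
      (∀ t : unitInterval, t ≠ 1 → π.map (fun γ => γ t) ≪ m)

/-- Geodesic metric space: any two points are joined by a constant-speed geodesic. -/
def GeodesicMS (X : Type*) [MetricSpace X] : Prop :=
  ∀ x y : X, ∃ γ : C(unitInterval, X), IsCSGeodesic γ ∧ γ 0 = x ∧ γ 1 = y

/-- The distortion coefficient `σ^{(t)}_{K,M}(θ)`. -/
def sigmaCoef (K M t θ : ℝ) : ℝ≥0∞ :=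
  if K * θ ^ 2 = 0 then ENNReal.ofReal t
  else if 0 < K then
    (if θ * Real.sqrt (K / M) < Real.pi then
      ENNReal.ofReal (Real.sin (t * θ * Real.sqrt (K / M)) / Real.sin (θ * Real.sqrt (K / M)))
    else ⊤)
  else ENNReal.ofReal (Real.sinh (t * θ * Real.sqrt (-K / M)) / Real.sinh (θ * Real.sqrt (-K / M)))

/-- The dynamical distortion coefficient `τ^{(t)}_{K,N}(θ)`. -/
def tauCoef (K N t θ : ℝ) : ℝ≥0∞ :=
  ENNReal.ofReal t ^ (1 / N) * sigmaCoef K (N - 1) t θ ^ ((N - 1) / N)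

/-- Milman's quasi curvature-dimension condition `QCD(Q,K,N)`. -/
def IsQCD {X : Type*} [MetricSpace X] [MeasurableSpace X] (m : Measure X) (Q K N : ℝ) : Prop :=
  GeodesicMS X ∧ IsMonge m ∧
  ∀ (μ0 μ1 : Measure X) (π : Measure C(unitInterval, X)) (ρ : unitInterval → X → ℝ≥0∞),
    IsProbabilityMeasure μ0 → IsProbabilityMeasure μ1 →
    (∃ C0 : Set X, IsCompact C0 ∧ μ0 C0ᶜ = 0) → (∃ C1 : Set X, IsCompact C1 ∧ μ1 C1ᶜ = 0) →
    μ0 ≪ m → μ1 ≪ m → IsOptDynPlan π μ0 μ1 →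
    (∀ t : unitInterval, π.map (fun γ => γ t) = m.withDensity (ρ t)) →
    ∀ t : unitInterval, (t : ℝ) ∈ Set.Ioo (0 : ℝ) 1 →
      ∀ᵐ γ ∂π,
        ENNReal.ofReal Q ^ (-(1 / N)) *
          (tauCoef K N (1 - (t : ℝ)) (dist (γ 0) (γ 1)) * ((ρ 0 (γ 0))⁻¹ ^ (1 / N)) +
            tauCoef K N (t : ℝ) (dist (γ 0) (γ 1)) * ((ρ 1 (γ 1))⁻¹ ^ (1 / N))) ≤
        (ρ t (γ t))⁻¹ ^ (1 / N)

/-- The model volume coefficient `s_{K,N}`. -/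
def sModel (K N r : ℝ) : ℝ :=
  if 0 < K then Real.sin (Real.sqrt (K / (N - 1)) * r)
  else if K = 0 then r
  else Real.sinh (Real.sqrt (-K / (N - 1)) * r)

end

/-- A nonnegative matrix of total mass one can be corrected to have prescribed row and column sums
that dominate `c` times the original ones, at a cost proportional to the defect `1 - c`. -/
theorem exists_matrix_of_mul_sum_le {ι κ : Type*} [Fintype ι] [Fintype κ]
    (a C : ι → κ → ℝ≥0∞) (r : ι → ℝ≥0∞) (s : κ → ℝ≥0∞) {c e D : ℝ≥0∞}
    (hce : c + e = 1) (he : e ≠ 0) (ha : ∑ i, ∑ j, a i j = 1)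
    (hr : ∑ i, r i = 1) (hs : ∑ j, s j = 1)
    (har : ∀ i, c * ∑ j, a i j ≤ r i) (has : ∀ j, c * ∑ i, a i j ≤ s j)
    (hCD : ∀ i j, C i j ≤ D) :
    ∃ b : ι → κ → ℝ≥0∞, (∀ i, ∑ j, b i j = r i) ∧ (∀ j, ∑ i, b i j = s j) ∧
      ∑ i, ∑ j, b i j * C i j ≤ ∑ i, ∑ j, a i j * C i j + e * D := by
  have hc1 : c ≤ 1 := hce ▸ le_self_add
  have he1 : e ≤ 1 := hce ▸ le_add_self
  have hct : c ≠ ⊤ := ne_top_of_le_ne_top one_ne_top hc1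
  have het : e ≠ ⊤ := ne_top_of_le_ne_top one_ne_top he1
  choose u hu using fun i => exists_add_of_le (har i)
  choose v hv using fun j => exists_add_of_le (has j)
  have hu_sum : ∑ i, u i = e := by
    refine (ENNReal.add_right_inj hct).1 ?_
    rw [hce, ← hr, Finset.sum_congr rfl fun i _ => hu i, Finset.sum_add_distrib, ← Finset.mul_sum,
      ha, mul_one]
  have hv_sum : ∑ j, v j = e := by
    refine (ENNReal.add_right_inj hct).1 ?_
    rw [hce, ← hs, Finset.sum_congr rfl fun j _ => hv j, Finset.sum_add_distrib, ← Finset.mul_sum,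
      Finset.sum_comm, ha, mul_one]
  refine ⟨fun i j => c * a i j + e⁻¹ * (u i * v j), fun i => ?_, fun j => ?_, ?_⟩
  · rw [Finset.sum_add_distrib, ← Finset.mul_sum, ← Finset.mul_sum, ← Finset.mul_sum, hv_sum, hu i,
      mul_comm (u i), ← mul_assoc, ENNReal.inv_mul_cancel he het, one_mul]
  · rw [Finset.sum_add_distrib, ← Finset.mul_sum, ← Finset.mul_sum, ← Finset.sum_mul, hu_sum, hv j,
      ← mul_assoc, ENNReal.inv_mul_cancel he het, one_mul]
  · calc ∑ i, ∑ j, (c * a i j + e⁻¹ * (u i * v j)) * C i j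
        ≤ ∑ i, ∑ j, (a i j * C i j + e⁻¹ * (u i * v j) * D) := by
          gcongr with i _ j _
          rw [add_mul]
          gcongr
          · exact mul_le_of_le_one_left' hc1
          · exact hCD i j
      _ = ∑ i, ∑ j, a i j * C i j + e⁻¹ * (e * e) * D := by
          simp only [Finset.sum_add_distrib, ← Finset.sum_mul, ← Finset.mul_sum, hv_sum, hu_sum]
      _ = ∑ i, ∑ j, a i j * C i j + e * D := by
          rw [← mul_assoc e⁻¹, ENNReal.inv_mul_cancel he het, one_mul]

/-- A discrete transport plan between the masses of two finite families of measures bounds the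
transport cost between their sums. -/
theorem W2sq_sum_le {X : Type*} [MetricSpace X] [MeasurableSpace X]
    {ι κ : Type*} [Fintype ι] [Fintype κ] (α : ι → Measure X) (β : κ → Measure X)
    [∀ i, IsFiniteMeasure (α i)] [∀ j, IsFiniteMeasure (β j)] (a C : ι → κ → ℝ≥0∞)
    (hα : ∀ i, ∑ j, a i j = α i univ) (hβ : ∀ j, ∑ i, a i j = β j univ)
    (hC : ∀ i j, ∀ᵐ p ∂(α i).prod (β j), edist p.1 p.2 ^ 2 ≤ C i j) :
    W2sq (∑ i, α i) (∑ j, β j) ≤ ∑ i, ∑ j, a i j * C i j := by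
  have ha0 : ∀ i j, α i univ = 0 → a i j = 0 := fun i j h =>
    (Finset.sum_eq_zero_iff.1 ((hα i).trans h)) j (Finset.mem_univ j)
  have hb0 : ∀ i j, β j univ = 0 → a i j = 0 := fun i j h =>
    (Finset.sum_eq_zero_iff.1 ((hβ j).trans h)) i (Finset.mem_univ i)
  have hwα : ∀ i j, a i j / (α i univ * β j univ) * α i univ * β j univ = a i j := by
    intro i j
    rw [mul_assoc]
    refine ENNReal.div_mul_cancel' (fun h => ?_)
      (fun h => absurd h (ENNReal.mul_ne_top (measure_ne_top _ _) (measure_ne_top _ _)))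
    rcases mul_eq_zero.1 h with h | h
    exacts [ha0 i j h, hb0 i j h]
  let ρ : Measure (X × X) :=
    ∑ i, ∑ j, (a i j / (α i univ * β j univ)) • (α i).prod (β j)
  have hfst : ρ.map Prod.fst = ∑ i, α i := by
    ext s hs
    simp only [ρ, Measure.map_apply measurable_fst hs, Measure.finsetSum_apply, Measure.smul_apply,
      smul_eq_mul]
    refine Finset.sum_congr rfl fun i _ => ?_
    have hp : ∀ j, (α i).prod (β j) (Prod.fst ⁻¹' s) = α i s * β j univ := fun j => by
      rw [← Set.prod_univ, Measure.prod_prod]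
    simp only [hp]
    rcases eq_or_ne (α i univ) 0 with h | h
    · have : α i s = 0 := measure_mono_null (subset_univ s) h
      simp [this]
    · refine (ENNReal.mul_left_inj h (measure_ne_top _ _)).1 ?_
      rw [Finset.sum_mul, mul_comm (α i s), ← hα i, Finset.sum_mul, hα i]
      refine Finset.sum_congr rfl fun j _ => ?_
      conv_rhs => rw [← hwα i j]
      ring
  have hsnd : ρ.map Prod.snd = ∑ j, β j := by
    ext s hs
    simp only [ρ, Measure.map_apply measurable_snd hs, Measure.finsetSum_apply, Measure.smul_apply,
      smul_eq_mul]
    rw [Finset.sum_comm]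
    refine Finset.sum_congr rfl fun j _ => ?_
    have hp : ∀ i, (α i).prod (β j) (Prod.snd ⁻¹' s) = α i univ * β j s := fun i => by
      rw [← Set.univ_prod, Measure.prod_prod]
    simp only [hp]
    rcases eq_or_ne (β j univ) 0 with h | h
    · have : β j s = 0 := measure_mono_null (subset_univ s) h
      simp [this]
    · refine (ENNReal.mul_left_inj h (measure_ne_top _ _)).1 ?_
      rw [Finset.sum_mul, mul_comm (β j s), ← hβ j, Finset.sum_mul, hβ j]
      refine Finset.sum_congr rfl fun i _ => ?_
      conv_rhs => rw [← hwα i j]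
      ring
  refine (iInf₂_le ρ ⟨hfst, hsnd⟩).trans ?_
  simp only [ρ, lintegral_finsetSum_measure, lintegral_smul_measure, smul_eq_mul]
  refine Finset.sum_le_sum fun i _ => Finset.sum_le_sum fun j _ => ?_
  calc a i j / (α i univ * β j univ) * ∫⁻ p, edist p.1 p.2 ^ 2 ∂(α i).prod (β j)
      ≤ a i j / (α i univ * β j univ) * ∫⁻ _, C i j ∂(α i).prod (β j) := by
        exact mul_le_mul_right (lintegral_mono_ae (hC i j)) _
    _ = a i j * C i j := by
        rw [lintegral_const, ← Set.univ_prod_univ, Measure.prod_prod, mul_comm (C i j),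
          ← mul_assoc, ← mul_assoc, hwα]

/-- A compact set admits a finite continuous partition of unity with supports of radius `δ` around
points of the set. -/
theorem IsCompact.exists_finset_partition {X : Type*} [MetricSpace X] {K : Set X}
    (hK : IsCompact K) {δ : ℝ} (hδ : 0 < δ) :
    ∃ (t : Finset X) (f : t → BoundedContinuousFunction X ℝ≥0), (t : Set X) ⊆ K ∧
      (∀ x ∈ K, ∑ i, f i x = 1) ∧ ∀ i x, f i x ≠ 0 → dist x i < δ := by
  obtain ⟨t, htK, ht⟩ := hK.elim_nhds_subcover (fun x => ball x δ) fun x _ => ball_mem_nhds x hδ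
  obtain ⟨f, hf⟩ := PartitionOfUnity.exists_isSubordinate_of_locallyFinite hK.isClosed
    (fun i : t => ball (i : X) δ) (fun _ => isOpen_ball) (locallyFinite_of_finite _)
    (ht.trans (by simp [iUnion_subtype]))
  refine ⟨t, fun i => BoundedContinuousFunction.mkOfBound
    ⟨fun x => (f i x).toNNReal, by fun_prop⟩ 1 fun x y => ?_, htK, fun x hx => ?_, fun i x h => ?_⟩
  · simp only [ContinuousMap.coe_mk, NNReal.dist_eq, Real.coe_toNNReal _ (f.nonneg i _)]
    rw [abs_le]
    constructor <;> linarith [f.nonneg i x, f.nonneg i y, f.le_one i x, f.le_one i y]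
  · have := f.sum_eq_one hx
    rw [finsum_eq_sum_of_fintype] at this
    apply NNReal.coe_injective
    simpa [Real.coe_toNNReal _ (f.nonneg _ _)] using this
  · have : x ∈ Function.support (f i) := by
      intro h0
      exact h (by simp [h0])
    exact hf i (subset_closure this)

/-- A partition of unity decomposes every measure concentrated on the partitioned set. -/
theorem sum_withDensity_eq_self {X ι : Type*} [TopologicalSpace X] [MeasurableSpace X]
    [OpensMeasurableSpace X] [Fintype ι] {f : ι → BoundedContinuousFunction X ℝ≥0} {K : Set X}
    (hf : ∀ x ∈ K, ∑ i, f i x = 1) {η : Measure X} (hη : η Kᶜ = 0) :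
    ∑ i, η.withDensity (fun x => f i x) = η := by
  have hfm : ∀ i, Measurable fun x => (f i x : ℝ≥0∞) := fun i =>
    (ENNReal.continuous_coe.comp (f i).continuous).measurable
  have hK : ∀ᵐ x ∂η, x ∈ K := hη
  ext s hs
  simp only [Measure.finsetSum_apply, withDensity_apply _ hs]
  rw [← lintegral_finsetSum _ fun i _ => hfm i, ← setLIntegral_one]
  refine lintegral_congr_ae ?_
  filter_upwards [ae_restrict_of_ae hK] with x hx
  rw [← ENNReal.ofNNReal_finsetSum, hf x hx, ENNReal.coe_one]

theorem eventually_mul_le_of_tendsto {Y : Type*} {F : Filter Y} {u : Y → ℝ≥0∞} {x c : ℝ≥0∞}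
    (hu : Tendsto u F (𝓝 x)) (hx : x ≠ ⊤) (hc : c < 1) : ∀ᶠ y in F, c * x ≤ u y := by
  rcases eq_or_ne x 0 with rfl | h0
  · simp
  · have : c * x < x := by
      simpa using (ENNReal.mul_lt_mul_iff_left h0 hx).2 hc
    filter_upwards [hu.eventually_const_lt this] with y hy using hy.le

/-- Upper semicontinuity of the squared Wasserstein distance along narrowly converging families
of measures concentrated on compact sets. -/
theorem eventually_W2sq_le_lintegral_add {X Y : Type*} [MetricSpace X] [SecondCountableTopology X]
    [MeasurableSpace X] [BorelSpace X] {K₀ K₁ : Set X} (hK₀ : IsCompact K₀) (hK₁ : IsCompact K₁)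
    {F : Filter Y} {μs νs : Y → ProbabilityMeasure X} {μ ν : ProbabilityMeasure X}
    (hμs : Tendsto μs F (𝓝 μ)) (hνs : Tendsto νs F (𝓝 ν))
    (hμsK : ∀ᶠ y in F, (μs y : Measure X) K₀ᶜ = 0) (hνsK : ∀ᶠ y in F, (νs y : Measure X) K₁ᶜ = 0)
    (hμK : (μ : Measure X) K₀ᶜ = 0) (hνK : (ν : Measure X) K₁ᶜ = 0)
    {ρ : Measure (X × X)} (hρ₀ : ρ.map Prod.fst = μ) (hρ₁ : ρ.map Prod.snd = ν)
    {ε : ℝ} (hε : 0 < ε) :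
    ∀ᶠ y in F, W2sq (μs y : Measure X) (νs y : Measure X) ≤
      ∫⁻ p, edist p.1 p.2 ^ 2 ∂ρ + ENNReal.ofReal ε := by
  have hρ : IsProbabilityMeasure ρ := by
    refine ⟨?_⟩
    rw [← preimage_univ (f := Prod.fst), ← Measure.map_apply measurable_fst MeasurableSet.univ, hρ₀]
    exact measure_univ
  obtain ⟨R, hR0, hR⟩ : ∃ R : ℝ, 0 ≤ R ∧ ∀ x ∈ K₀, ∀ y ∈ K₁, dist x y ≤ R := by
    obtain ⟨R, hR⟩ := isBounded_iff.1 (hK₀.union hK₁).isBounded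
    exact ⟨max R 0, le_max_right _ _, fun x hx y hy =>
      (hR (Or.inl hx) (Or.inr hy)).trans (le_max_left _ _)⟩
  set δ : ℝ := min 1 (ε / (2 * (8 * R + 16)))
  have hδ : 0 < δ := by positivity
  have hδ1 : δ ≤ 1 := min_le_left _ _
  have hδε : 8 * δ * R + 16 * δ ^ 2 ≤ ε / 2 := by
    have h1 : δ * (2 * (8 * R + 16)) ≤ ε := (le_div_iff₀ (by positivity)).1 (min_le_right _ _)
    nlinarith
  set e : ℝ := min (1 / 2) (ε / (2 * (R + 2) ^ 2))
  have he : 0 < e := by positivity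
  have he1 : e ≤ 1 / 2 := min_le_left _ _
  have heε : e * (R + 2) ^ 2 ≤ ε / 2 := by
    have h1 : e * (2 * (R + 2) ^ 2) ≤ ε := (le_div_iff₀ (by positivity)).1 (min_le_right _ _)
    linarith
  obtain ⟨t₀, f, ht₀, hf_sum, hf⟩ := hK₀.exists_finset_partition hδ
  obtain ⟨t₁, g, ht₁, hg_sum, hg⟩ := hK₁.exists_finset_partition hδ
  have hfm : ∀ i, Measurable fun x => (f i x : ℝ≥0∞) := fun i =>
    (ENNReal.continuous_coe.comp (f i).continuous).measurable
  have hgm : ∀ j, Measurable fun x => (g j x : ℝ≥0∞) := fun j =>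
    (ENNReal.continuous_coe.comp (g j).continuous).measurable
  have hf_sum' : ∀ x ∈ K₀, ∑ i, (f i x : ℝ≥0∞) = 1 := fun x hx => by
    rw [← ENNReal.ofNNReal_finsetSum, hf_sum x hx, ENNReal.coe_one]
  have hg_sum' : ∀ x ∈ K₁, ∑ j, (g j x : ℝ≥0∞) = 1 := fun x hx => by
    rw [← ENNReal.ofNNReal_finsetSum, hg_sum x hx, ENNReal.coe_one]
  have hρK₀ : ∀ᵐ p ∂ρ, p.1 ∈ K₀ := by
    refine ae_of_ae_map (p := (· ∈ K₀)) measurable_fst.aemeasurable ?_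
    rw [hρ₀]
    exact hμK
  have hρK₁ : ∀ᵐ p ∂ρ, p.2 ∈ K₁ := by
    refine ae_of_ae_map (p := (· ∈ K₁)) measurable_snd.aemeasurable ?_
    rw [hρ₁]
    exact hνK
  let a : t₀ → t₁ → ℝ≥0∞ := fun i j => ∫⁻ p, f i p.1 * g j p.2 ∂ρ
  let C : t₀ → t₁ → ℝ≥0∞ := fun i j => ENNReal.ofReal ((dist (i : X) j + 2 * δ) ^ 2)
  have hfg : ∀ i j, Measurable fun p : X × X => (f i p.1 * g j p.2 : ℝ≥0∞) := fun i j =>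
    ((hfm i).comp measurable_fst).mul ((hgm j).comp measurable_snd)
  have ha₀ : ∀ i, ∑ j, a i j = ∫⁻ x, f i x ∂(μ : Measure X) := fun i => by
    rw [← hρ₀, lintegral_map (hfm i) measurable_fst, ← lintegral_finsetSum _ fun j _ => hfg i j]
    refine lintegral_congr_ae ?_
    filter_upwards [hρK₁] with p hp
    rw [← Finset.mul_sum, hg_sum' _ hp, mul_one]
  have ha₁ : ∀ j, ∑ i, a i j = ∫⁻ x, g j x ∂(ν : Measure X) := fun j => by
    rw [← hρ₁, lintegral_map (hgm j) measurable_snd, ← lintegral_finsetSum _ fun i _ => hfg i j]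
    refine lintegral_congr_ae ?_
    filter_upwards [hρK₀] with p hp
    rw [← Finset.sum_mul, hf_sum' _ hp, one_mul]
  have hmass : ∀ (h : BoundedContinuousFunction X ℝ≥0) (η : Measure X),
      η.withDensity (fun x => h x) univ = ∫⁻ x, h x ∂η := fun h η => by
    rw [withDensity_apply _ MeasurableSet.univ, Measure.restrict_univ]
  have hfin : ∀ (h : BoundedContinuousFunction X ℝ≥0) (η : ProbabilityMeasure X),
      IsFiniteMeasure ((η : Measure X).withDensity fun x => h x) := fun h η =>
    ⟨(hmass h η).trans_lt (h.lintegral_lt_top_of_nnreal _)⟩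
  have hsum_f : ∀ η : ProbabilityMeasure X, (η : Measure X) K₀ᶜ = 0 →
      ∑ i, ∫⁻ x, f i x ∂(η : Measure X) = 1 := fun η hη => by
    simp only [← hmass]
    rw [← Measure.finsetSum_apply, sum_withDensity_eq_self hf_sum hη, measure_univ]
  have hsum_g : ∀ η : ProbabilityMeasure X, (η : Measure X) K₁ᶜ = 0 →
      ∑ j, ∫⁻ x, g j x ∂(η : Measure X) = 1 := fun η hη => by
    simp only [← hmass]
    rw [← Measure.finsetSum_apply, sum_withDensity_eq_self hg_sum hη, measure_univ]
  have ha_sum : ∑ i, ∑ j, a i j = 1 := by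
    rw [Finset.sum_congr rfl fun i _ => ha₀ i, hsum_f μ hμK]
  have hc : ENNReal.ofReal (1 - e) < 1 := by
    rw [ENNReal.ofReal_lt_one]
    linarith
  have hce : ENNReal.ofReal (1 - e) + ENNReal.ofReal e = 1 := by
    rw [← ENNReal.ofReal_add (by linarith) he.le, sub_add_cancel, ENNReal.ofReal_one]
  have hCD : ∀ i j, C i j ≤ ENNReal.ofReal ((R + 2) ^ 2) := fun i j => by
    have := hR i (ht₀ i.2) j (ht₁ j.2)
    refine ENNReal.ofReal_le_ofReal (pow_le_pow_left₀ (by positivity) ?_ 2)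
    linarith
  have hcost : ∑ i, ∑ j, a i j * C i j ≤
      ∫⁻ p, edist p.1 p.2 ^ 2 ∂ρ + ENNReal.ofReal (ε / 2) := by
    calc ∑ i, ∑ j, a i j * C i j
        = ∫⁻ p, ∑ i, ∑ j, f i p.1 * g j p.2 * C i j ∂ρ := by
          rw [lintegral_finsetSum _ fun i _ =>
            Finset.measurable_fun_sum _ fun j _ => (hfg i j).mul_const _]
          refine Finset.sum_congr rfl fun i _ => ?_
          rw [lintegral_finsetSum _ fun j _ => (hfg i j).mul_const _]
          exact Finset.sum_congr rfl fun j _ => (lintegral_mul_const _ (hfg i j)).symm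
      _ ≤ ∫⁻ p, (edist p.1 p.2 ^ 2 + ENNReal.ofReal (ε / 2)) ∂ρ := by
          refine lintegral_mono_ae ?_
          filter_upwards [hρK₀, hρK₁] with p hp₀ hp₁
          calc ∑ i, ∑ j, (f i p.1 * g j p.2 * C i j : ℝ≥0∞)
              ≤ ∑ i, ∑ j, f i p.1 * g j p.2 * (edist p.1 p.2 ^ 2 + ENNReal.ofReal (ε / 2)) := by
                refine Finset.sum_le_sum fun i _ => Finset.sum_le_sum fun j _ => ?_
                rcases eq_or_ne (f i p.1) 0 with h0 | h0
                · simp [h0]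
                rcases eq_or_ne (g j p.2) 0 with h1 | h1
                · simp [h1]
                refine mul_le_mul_right ?_ _
                have hi := hf i _ h0
                have hj := hg j _ h1
                have hd := dist_triangle4 (i : X) p.1 p.2 j
                rw [dist_comm (i : X) p.1] at hd
                have hpR := hR _ hp₀ _ hp₁
                rw [edist_dist, ← ENNReal.ofReal_pow dist_nonneg,
                  ← ENNReal.ofReal_add (by positivity) (by positivity)]
                refine ENNReal.ofReal_le_ofReal ?_
                calc (dist (i : X) j + 2 * δ) ^ 2 ≤ (dist p.1 p.2 + 4 * δ) ^ 2 :=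
                      pow_le_pow_left₀ (by positivity) (by linarith) 2
                  _ ≤ dist p.1 p.2 ^ 2 + ε / 2 := by
                      nlinarith [mul_le_mul_of_nonneg_left hpR hδ.le]
            _ = edist p.1 p.2 ^ 2 + ENNReal.ofReal (ε / 2) := by
                simp only [← Finset.sum_mul, ← Finset.mul_sum, hg_sum' _ hp₁, hf_sum' _ hp₀,
                  one_mul]
      _ = ∫⁻ p, edist p.1 p.2 ^ 2 ∂ρ + ENNReal.ofReal (ε / 2) := by
          rw [lintegral_add_right _ measurable_const, lintegral_const, measure_univ, mul_one]
  have hμs_ev : ∀ᶠ y in F, ∀ i, ENNReal.ofReal (1 - e) * ∫⁻ x, f i x ∂(μ : Measure X) ≤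
      ∫⁻ x, f i x ∂(μs y : Measure X) := eventually_all.2 fun i =>
    eventually_mul_le_of_tendsto
      (ProbabilityMeasure.tendsto_iff_forall_lintegral_tendsto.1 hμs (f i))
      ((f i).lintegral_lt_top_of_nnreal _).ne hc
  have hνs_ev : ∀ᶠ y in F, ∀ j, ENNReal.ofReal (1 - e) * ∫⁻ x, g j x ∂(ν : Measure X) ≤
      ∫⁻ x, g j x ∂(νs y : Measure X) := eventually_all.2 fun j =>
    eventually_mul_le_of_tendsto
      (ProbabilityMeasure.tendsto_iff_forall_lintegral_tendsto.1 hνs (g j))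
      ((g j).lintegral_lt_top_of_nnreal _).ne hc
  filter_upwards [hμs_ev, hνs_ev, hμsK, hνsK] with y hyμ hyν hyK₀ hyK₁
  obtain ⟨b, hb₀, hb₁, hb⟩ := exists_matrix_of_mul_sum_le a C
    (fun i => ∫⁻ x, f i x ∂(μs y : Measure X)) (fun j => ∫⁻ x, g j x ∂(νs y : Measure X))
    hce (by simpa using he) ha_sum (hsum_f _ hyK₀) (hsum_g _ hyK₁)
    (fun i => by simpa only [ha₀] using hyμ i) (fun j => by simpa only [ha₁] using hyν j) hCD
  have hW := W2sq_sum_le (fun i => (μs y : Measure X).withDensity fun x => f i x)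
    (fun j => (νs y : Measure X).withDensity fun x => g j x) b C
    (fun i => (hb₀ i).trans (hmass (f i) _).symm) (fun j => (hb₁ j).trans (hmass (g j) _).symm)
    (fun i j => by
      have h₀ : ∀ᵐ x ∂(μs y : Measure X).withDensity (fun x => f i x), dist x (i : X) < δ :=
        (ae_withDensity_iff (hfm i)).2 (.of_forall fun x hx => hf i x (by simpa using hx))
      have h₁ : ∀ᵐ x ∂(νs y : Measure X).withDensity (fun x => g j x), dist x (j : X) < δ :=
        (ae_withDensity_iff (hgm j)).2 (.of_forall fun x hx => hg j x (by simpa using hx))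
      filter_upwards [Measure.quasiMeasurePreserving_fst.ae h₀,
        Measure.quasiMeasurePreserving_snd.ae h₁] with p hp₀ hp₁
      have hd := dist_triangle4 p.1 (i : X) j p.2
      rw [dist_comm (j : X) p.2] at hd
      rw [edist_dist, ← ENNReal.ofReal_pow dist_nonneg]
      exact ENNReal.ofReal_le_ofReal (pow_le_pow_left₀ dist_nonneg (by linarith) 2))
  rw [sum_withDensity_eq_self hf_sum hyK₀, sum_withDensity_eq_self hg_sum hyK₁] at hW
  calc W2sq (μs y : Measure X) (νs y : Measure X)
      ≤ ∑ i, ∑ j, a i j * C i j + ENNReal.ofReal e * ENNReal.ofReal ((R + 2) ^ 2) := hW.trans hb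
    _ ≤ ∫⁻ p, edist p.1 p.2 ^ 2 ∂ρ + ENNReal.ofReal (ε / 2) + ENNReal.ofReal (ε / 2) := by
        rw [← ENNReal.ofReal_mul he.le]
        exact add_le_add hcost (ENNReal.ofReal_le_ofReal heε)
    _ = ∫⁻ p, edist p.1 p.2 ^ 2 ∂ρ + ENNReal.ofReal ε := by
        rw [add_assoc, ← ENNReal.ofReal_add (by positivity) (by positivity), add_halves]

theorem IsCSGeodesic.dist_le {X : Type*} [MetricSpace X] {γ : C(unitInterval, X)}
    (hγ : IsCSGeodesic γ) (s t : unitInterval) : dist (γ s) (γ t) ≤ dist (γ 0) (γ 1) := by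
  rw [hγ s t]
  refine mul_le_of_le_one_left dist_nonneg ?_
  rw [abs_le]
  constructor <;> linarith [s.2.1, s.2.2, t.2.1, t.2.2]

/-- In a proper space, the geodesics joining two compact sets form a compact set of paths. -/
theorem isCompact_setOfPred_isCSGeodesic {X : Type*} [MetricSpace X] [ProperSpace X] {K₀ K₁ : Set X}
    (hK₀ : IsCompact K₀) (hK₁ : IsCompact K₁) :
    IsCompact {γ : C(unitInterval, X) | IsCSGeodesic γ ∧ γ 0 ∈ K₀ ∧ γ 1 ∈ K₁} := by
  obtain ⟨R, hR⟩ := isBounded_iff.1 (hK₀.union hK₁).isBounded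
  have hlip : ∀ f : unitInterval → X,
      (∀ s t : unitInterval, dist (f s) (f t) = |(t : ℝ) - (s : ℝ)| * dist (f 0) (f 1)) →
      f 0 ∈ K₀ → f 1 ∈ K₁ → LipschitzWith R.toNNReal f := by
    intro f hf h0 h1
    refine LipschitzWith.of_dist_le_mul fun s t => ?_
    rw [hf s t, mul_comm, dist_comm s t, Subtype.dist_eq, Real.dist_eq]
    exact mul_le_mul_of_nonneg_right
      ((hR (Or.inl h0) (Or.inr h1)).trans (Real.le_coe_toNNReal R)) (abs_nonneg _)
  refine ArzelaAscoli.isCompact_of_equicontinuous _ ?_ ?_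
  · have himage : ContinuousMap.toFun ''
        {γ : C(unitInterval, X) | IsCSGeodesic γ ∧ γ 0 ∈ K₀ ∧ γ 1 ∈ K₁} =
        {f : unitInterval → X | (∀ s t : unitInterval,
          dist (f s) (f t) = |(t : ℝ) - (s : ℝ)| * dist (f 0) (f 1)) ∧ f 0 ∈ K₀ ∧ f 1 ∈ K₁} := by
      ext f
      constructor
      · rintro ⟨γ, hγ, rfl⟩
        exact hγ
      · intro hf
        exact ⟨⟨f, (hlip f hf.1 hf.2.1 hf.2.2).continuous⟩, hf, rfl⟩
    rw [himage]
    have hclosed : IsClosed {f : unitInterval → X | (∀ s t : unitInterval,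
        dist (f s) (f t) = |(t : ℝ) - (s : ℝ)| * dist (f 0) (f 1)) ∧ f 0 ∈ K₀ ∧ f 1 ∈ K₁} := by
      simp only [ofPred_and, ofPred_forall]
      refine (isClosed_iInter fun s => isClosed_iInter fun t =>
        isClosed_eq (by fun_prop) (by fun_prop)).inter ?_
      exact (hK₀.isClosed.preimage (continuous_apply 0)).inter
        (hK₁.isClosed.preimage (continuous_apply 1))
    refine (isCompact_univ_pi fun t : unitInterval =>
      hK₀.cthickening (r := R)).of_isClosed_subset hclosed fun f hf t _ => ?_
    refine mem_cthickening_of_dist_le (f t) (f 0) R K₀ hf.2.1 ?_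
    exact (IsCSGeodesic.dist_le (γ := ⟨f, (hlip f hf.1 hf.2.1 hf.2.2).continuous⟩) hf.1 t 0).trans
      (hR (Or.inl hf.2.1) (Or.inr hf.2.2))
  · exact (LipschitzWith.uniformEquicontinuous _ R.toNNReal fun γ =>
      hlip _ γ.2.1 γ.2.2.1 γ.2.2.2).equicontinuous

theorem finSecondMoment_of_isCompact {X : Type*} [MetricSpace X] [MeasurableSpace X]
    {K : Set X} (hK : IsCompact K) (μ : Measure X) [IsProbabilityMeasure μ] (hμ : μ Kᶜ = 0) :
    FinSecondMoment μ := by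
  have hμ' : ∀ᵐ x ∂μ, x ∈ K := hμ
  obtain ⟨x₀, hx₀⟩ := hμ'.exists
  refine ⟨x₀, ne_top_of_le_ne_top (b := ediam K ^ 2) ?_ ?_⟩
  · exact ENNReal.pow_ne_top hK.isBounded.ediam_ne_top
  · calc ∫⁻ x, edist x x₀ ^ 2 ∂μ ≤ ∫⁻ _, ediam K ^ 2 ∂μ := by
          refine lintegral_mono_ae ?_
          filter_upwards [hμ'] with x hx
          exact pow_le_pow_left₀ zero_le (edist_le_ediam_of_mem hx hx₀) 2
      _ = ediam K ^ 2 := by simp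

/-- The cost of a dynamical plan is at least the squared Wasserstein distance of its marginals. -/
theorem W2sq_map_le_lintegral {X : Type*} [MetricSpace X] [SecondCountableTopology X]
    [MeasurableSpace X] [BorelSpace X] (π : Measure C(unitInterval, X)) :
    W2sq (π.map fun γ => γ 0) (π.map fun γ => γ 1) ≤ ∫⁻ γ, edist (γ 0) (γ 1) ^ 2 ∂π := by
  have h0 : Measurable fun γ : C(unitInterval, X) => γ 0 := (continuous_eval_const 0).measurable
  have h1 : Measurable fun γ : C(unitInterval, X) => γ 1 := (continuous_eval_const 1).measurable
  have hfst : (π.map fun γ => (γ 0, γ 1)).map Prod.fst = π.map fun γ => γ 0 := by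
    rw [Measure.map_map measurable_fst (h0.prodMk h1)]
    rfl
  have hsnd : (π.map fun γ => (γ 0, γ 1)).map Prod.snd = π.map fun γ => γ 1 := by
    rw [Measure.map_map measurable_snd (h0.prodMk h1)]
    rfl
  refine (iInf₂_le _ ⟨hfst, hsnd⟩).trans_eq ?_
  exact lintegral_map (measurable_edist.pow_const 2) (h0.prodMk h1)

/-- Narrow limits of optimal dynamical plans concentrated on the geodesics between two compact sets
are optimal. -/
theorem isOptDynPlan_of_tendsto {X Y : Type*} [MetricSpace X] [SecondCountableTopology X]
    [MeasurableSpace X] [BorelSpace X] {K₀ K₁ : Set X} (hK₀ : IsCompact K₀) (hK₁ : IsCompact K₁)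
    {F : Filter Y} [F.NeBot] {μs νs : Y → ProbabilityMeasure X} {μ ν : ProbabilityMeasure X}
    {πs : Y → ProbabilityMeasure C(unitInterval, X)} {π : ProbabilityMeasure C(unitInterval, X)}
    (hμs : Tendsto μs F (𝓝 μ)) (hνs : Tendsto νs F (𝓝 ν)) (hπs : Tendsto πs F (𝓝 π))
    (hμsK : ∀ᶠ y in F, (μs y : Measure X) K₀ᶜ = 0) (hνsK : ∀ᶠ y in F, (νs y : Measure X) K₁ᶜ = 0)
    (hμK : (μ : Measure X) K₀ᶜ = 0) (hνK : (ν : Measure X) K₁ᶜ = 0)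
    (hopt : ∀ᶠ y in F, IsOptDynPlan (πs y : Measure C(unitInterval, X)) (μs y : Measure X)
      (νs y : Measure X))
    (hπ : (π : Measure C(unitInterval, X)) {γ | ¬ IsCSGeodesic γ} = 0) :
    IsOptDynPlan (π : Measure C(unitInterval, X)) (μ : Measure X) (ν : Measure X) := by
  have hc0 : Continuous fun γ : C(unitInterval, X) => γ 0 := continuous_eval_const 0
  have hc1 : Continuous fun γ : C(unitInterval, X) => γ 1 := continuous_eval_const 1
  have h0 : (π : Measure C(unitInterval, X)).map (fun γ => γ 0) = μ := by
    have h := ProbabilityMeasure.tendsto_map_of_tendsto_of_continuous πs π hπs hc0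
    have h' : π.map hc0.measurable.aemeasurable = μ := by
      refine tendsto_nhds_unique h (hμs.congr' ?_)
      filter_upwards [hopt] with y hy
      exact Subtype.ext hy.2.2.1.symm
    exact congrArg Subtype.val h'
  have h1 : (π : Measure C(unitInterval, X)).map (fun γ => γ 1) = ν := by
    have h := ProbabilityMeasure.tendsto_map_of_tendsto_of_continuous πs π hπs hc1
    have h' : π.map hc1.measurable.aemeasurable = ν := by
      refine tendsto_nhds_unique h (hνs.congr' ?_)
      filter_upwards [hopt] with y hy
      exact Subtype.ext hy.2.2.2.1.symm
    exact congrArg Subtype.val h'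
  refine ⟨inferInstance, hπ, h0, h1, le_antisymm ?_ ?_⟩
  · obtain ⟨R, hR⟩ := isBounded_iff_nndist.1 (hK₀.union hK₁).isBounded
    let φ : BoundedContinuousFunction C(unitInterval, X) ℝ≥0 :=
      BoundedContinuousFunction.mkOfBound
        ⟨fun γ => min (nndist (γ 0) (γ 1) ^ 2) (R ^ 2), by fun_prop⟩ (R ^ 2) fun γ γ' => by
          rw [NNReal.dist_eq]
          exact abs_sub_le_of_nonneg_of_le (NNReal.coe_nonneg _)
            (NNReal.coe_le_coe.2 (min_le_right _ _)) (NNReal.coe_nonneg _)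
            (NNReal.coe_le_coe.2 (min_le_right _ _))
    have hφ : ∀ γ, (φ γ : ℝ≥0∞) ≤ edist (γ 0) (γ 1) ^ 2 := fun γ => by
      rw [edist_nndist, ← ENNReal.coe_pow]
      exact ENNReal.coe_le_coe.2 (min_le_left _ _)
    have hφπ : ∫⁻ γ, edist (γ 0) (γ 1) ^ 2 ∂(π : Measure C(unitInterval, X)) =
        ∫⁻ γ, φ γ ∂(π : Measure C(unitInterval, X)) := by
      have hπK₀ : ∀ᵐ γ ∂(π : Measure C(unitInterval, X)), γ 0 ∈ K₀ := by
        refine ae_of_ae_map (p := (· ∈ K₀)) hc0.measurable.aemeasurable ?_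
        rw [h0]
        exact hμK
      have hπK₁ : ∀ᵐ γ ∂(π : Measure C(unitInterval, X)), γ 1 ∈ K₁ := by
        refine ae_of_ae_map (p := (· ∈ K₁)) hc1.measurable.aemeasurable ?_
        rw [h1]
        exact hνK
      refine lintegral_congr_ae ?_
      filter_upwards [hπK₀, hπK₁] with γ hγ₀ hγ₁
      have hγ : nndist (γ 0) (γ 1) ^ 2 ≤ R ^ 2 :=
        pow_le_pow_left₀ zero_le (hR (Or.inl hγ₀) (Or.inr hγ₁)) 2
      rw [edist_nndist, ← ENNReal.coe_pow]
      exact congrArg _ (min_eq_left hγ).symm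
    rw [hφπ]
    refine le_iInf₂ fun ρ hρ => ENNReal.le_of_forall_pos_le_add fun ε hε _ => ?_
    refine le_of_tendsto (ProbabilityMeasure.tendsto_iff_forall_lintegral_tendsto.1 hπs φ) ?_
    filter_upwards [hopt, eventually_W2sq_le_lintegral_add hK₀ hK₁ hμs hνs hμsK hνsK hμK hνK
      hρ.1 hρ.2 (NNReal.coe_pos.2 hε)] with y hy hyW
    rw [ENNReal.ofReal_coe_nnreal, ← hy.2.2.2.2] at hyW
    exact (lintegral_mono hφ).trans hyW
  · rw [← h0, ← h1]
    exact W2sq_map_le_lintegral _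

/-- Continuity of the map sending a pair of marginals to the unique optimal dynamical plan,
on a proper geodesic Monge space. -/
theorem continuity_of_optimal_dynamical_plan
    {X : Type*} [MetricSpace X] [CompleteSpace X] [TopologicalSpace.SeparableSpace X]
    [ProperSpace X] [MeasurableSpace X] [BorelSpace X] (m : Measure X)
    (hfin : ∀ s : Set X, IsBounded s → m s ≠ ⊤)
    (hsupp : ∀ U : Set X, IsOpen U → U.Nonempty → m U ≠ 0)
    (hgeo : GeodesicMS X) (hmonge : IsMonge m)
    (K0 K1 : Set X) (hK0 : IsCompact K0) (hK1 : IsCompact K1)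
    (Pi : ProbabilityMeasure X → ProbabilityMeasure X → ProbabilityMeasure C(unitInterval, X))
    (hPi : ∀ μ0 μ1 : ProbabilityMeasure X,
      (μ0 : Measure X) ≪ m → (μ0 : Measure X) K0ᶜ = 0 → (μ1 : Measure X) K1ᶜ = 0 →
      IsOptDynPlan (Pi μ0 μ1 : Measure C(unitInterval, X)) (μ0 : Measure X) (μ1 : Measure X)) :
    ContinuousOn (fun p : ProbabilityMeasure X × ProbabilityMeasure X => Pi p.1 p.2)
      ({μ : ProbabilityMeasure X | (μ : Measure X) ≪ m ∧ (μ : Measure X) K0ᶜ = 0} ×ˢ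
        {μ : ProbabilityMeasure X | (μ : Measure X) K1ᶜ = 0}) := by
  have : SecondCountableTopology X := UniformSpace.secondCountable_of_separable X
  rintro ⟨μ, ν⟩ ⟨⟨hμm, hμK⟩, hνK⟩
  have hG := isCompact_setOfPred_isCSGeodesic hK0 hK1
  set G : Set C(unitInterval, X) := {γ | IsCSGeodesic γ ∧ γ 0 ∈ K0 ∧ γ 1 ∈ K1}
  have hcompact := isCompact_setOfPred_probabilityMeasure_mass_eq_compl_isCompact_le
    (u := fun _ => 0) (K := fun _ => G) tendsto_const_nhds (fun _ => hG) (Or.inr monotone_const)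
  refine hcompact.tendsto_nhds_of_unique_mapClusterPt ?_ ?_
  · filter_upwards [self_mem_nhdsWithin] with p hp _
    have hopt := hPi p.1 p.2 hp.1.1 hp.1.2 hp.2
    have h0 : ∀ᵐ γ ∂(Pi p.1 p.2 : Measure C(unitInterval, X)), γ 0 ∈ K0 := by
      refine ae_of_ae_map (p := (· ∈ K0)) (continuous_eval_const 0).measurable.aemeasurable ?_
      rw [hopt.2.2.1]
      exact hp.1.2
    have h1 : ∀ᵐ γ ∂(Pi p.1 p.2 : Measure C(unitInterval, X)), γ 1 ∈ K1 := by
      refine ae_of_ae_map (p := (· ∈ K1)) (continuous_eval_const 1).measurable.aemeasurable ?_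
      rw [hopt.2.2.2.1]
      exact hp.2
    have hgeod : ∀ᵐ γ ∂(Pi p.1 p.2 : Measure C(unitInterval, X)), IsCSGeodesic γ := hopt.2.1
    have hae : ∀ᵐ γ ∂(Pi p.1 p.2 : Measure C(unitInterval, X)), γ ∈ G := by
      filter_upwards [hgeod, h0, h1] with γ h h' h'' using ⟨h, h', h''⟩
    exact ((ProbabilityMeasure.null_iff_toMeasure_null _ _).2 hae).le
  · intro π hπ hcluster
    obtain ⟨U, hU, hUπ⟩ := mapClusterPt_iff_ultrafilter.1 hcluster
    have hUμν : Tendsto id (U : Filter (ProbabilityMeasure X × ProbabilityMeasure X))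
        (𝓝 (μ, ν)) := hU.trans nhdsWithin_le_nhds
    have hUS := hU self_mem_nhdsWithin
    have hπG : (π : Measure C(unitInterval, X)) Gᶜ = 0 :=
      (ProbabilityMeasure.null_iff_toMeasure_null _ _).1 (le_antisymm (hπ 0) zero_le)
    have hopt : IsOptDynPlan (π : Measure C(unitInterval, X)) (μ : Measure X) (ν : Measure X) := by
      refine isOptDynPlan_of_tendsto hK0 hK1 (continuous_fst.continuousAt.tendsto.comp hUμν)
        (continuous_snd.continuousAt.tendsto.comp hUμν) hUπ ?_ ?_ hμK hνK ?_
        (measure_mono_null (t := Gᶜ) (fun γ hγ hγG => hγ hγG.1) hπG)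
      · filter_upwards [hUS] with p hp using hp.1.2
      · filter_upwards [hUS] with p hp using hp.2
      · filter_upwards [hUS] with p hp using hPi p.1 p.2 hp.1.1 hp.1.2 hp.2
    exact Subtype.ext ((hmonge μ ν inferInstance inferInstance
      (finSecondMoment_of_isCompact hK0 _ hμK) (finSecondMoment_of_isCompact hK1 _ hνK)
      hμm).1.unique hopt (hPi μ ν hμm hμK hνK))
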